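/- arXiv:2011.14212 — 5 statements merged into one kernel-verified Lean document; each statement's English description precedes it below -/
import Mathlib

section
/- Let P and X be symmetric n×n real matrices and suppose Q_uu + BᵀPB is invertible. Then the map ε ↦ R(P + εX) (from real numbers to n×n real matrices) is differentiable at ε = 0, and its derivative there equals -X + (A + BK)ᵀ X (A + BK), where K = K(P). Equivalently, the directional derivative of the Riccati operator satisfies R′(P, X) = -X + (A + BK(P))ᵀ X (A + BK(P)). -/
open Matrix

attribute [local instance] Matrix.normedAddCommGroup Matrix.normedSpace

/-- The LQR gain operator `K(P) = -(Q_uu + BᵀPB)⁻¹ (Q_ux + BᵀPA)`. -/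
noncomputable def gainK {n m : ℕ} (A : Matrix (Fin n) (Fin n) ℝ) (B : Matrix (Fin n) (Fin m) ℝ)
    (Qux : Matrix (Fin m) (Fin n) ℝ) (Quu : Matrix (Fin m) (Fin m) ℝ)
    (P : Matrix (Fin n) (Fin n) ℝ) : Matrix (Fin m) (Fin n) ℝ :=
  -(Quu + Bᵀ * P * B)⁻¹ * (Qux + Bᵀ * P * A)

/-- The Riccati operator
`R(P) = -P + Q_xx + AᵀPA - (Q_xu + AᵀPB)(Q_uu + BᵀPB)⁻¹(Q_ux + BᵀPA)`. -/
noncomputable def Ricc {n m : ℕ} (A : Matrix (Fin n) (Fin n) ℝ) (B : Matrix (Fin n) (Fin m) ℝ)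
    (Qxx : Matrix (Fin n) (Fin n) ℝ) (Qxu : Matrix (Fin n) (Fin m) ℝ)
    (Qux : Matrix (Fin m) (Fin n) ℝ) (Quu : Matrix (Fin m) (Fin m) ℝ)
    (P : Matrix (Fin n) (Fin n) ℝ) : Matrix (Fin n) (Fin n) ℝ :=
  -P + Qxx + Aᵀ * P * A -
    (Qxu + Aᵀ * P * B) * (Quu + Bᵀ * P * B)⁻¹ * (Qux + Bᵀ * P * A)

/-- The directional derivative `R′(P, X) = lim_{ε → 0} (R(P + εX) - R(P))/ε` of the Riccati
operator at `P` in direction `X`, realized as the derivative of `ε ↦ R(P + εX)` at `ε = 0`. -/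
noncomputable def RiccDer {n m : ℕ} (A : Matrix (Fin n) (Fin n) ℝ) (B : Matrix (Fin n) (Fin m) ℝ)
    (Qxx : Matrix (Fin n) (Fin n) ℝ) (Qxu : Matrix (Fin n) (Fin m) ℝ)
    (Qux : Matrix (Fin m) (Fin n) ℝ) (Quu : Matrix (Fin m) (Fin m) ℝ)
    (P X : Matrix (Fin n) (Fin n) ℝ) : Matrix (Fin n) (Fin n) ℝ :=
  deriv (fun ε : ℝ => Ricc A B Qxx Qxu Qux Quu (P + ε • X)) 0

/-- The product rule for matrix-valued functions of a real variable. -/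
theorem HasDerivAt.matrix_mul_rect {k l p : ℕ} {F : ℝ → Matrix (Fin k) (Fin l) ℝ}
    {G : ℝ → Matrix (Fin l) (Fin p) ℝ} {F' : Matrix (Fin k) (Fin l) ℝ}
    {G' : Matrix (Fin l) (Fin p) ℝ} {t : ℝ} (hF : HasDerivAt F F' t) (hG : HasDerivAt G G' t) :
    HasDerivAt (fun ε => F ε * G ε) (F' * G t + F t * G') t := by
  have entry {a b : ℕ} {H : ℝ → Matrix (Fin a) (Fin b) ℝ} {H' : Matrix (Fin a) (Fin b) ℝ}
      (hH : HasDerivAt H H' t) (i : Fin a) (j : Fin b) :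
      HasDerivAt (fun ε => H ε i j) (H' i j) t :=
    hasDerivAt_pi.1 (hasDerivAt_pi.1 hH i) j
  refine hasDerivAt_pi.2 fun i => hasDerivAt_pi.2 fun j => ?_
  simp only [Matrix.mul_apply, Matrix.add_apply, ← Finset.sum_add_distrib]
  exact HasDerivAt.fun_sum fun r _ => (entry hF i r).fun_mul (entry hG r j)

/-- The derivative of a continuous functional of the inverse along an affine line. -/
theorem hasDerivAt_clm_ringInverse_add_smul {R : Type*} [NormedRing R] [NormedAlgebra ℝ R]
    [CompleteSpace R] (u : Rˣ) (N : R) (L : R →L[ℝ] ℝ) :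
    HasDerivAt (fun ε : ℝ => L (Ring.inverse (u + ε • N)))
      (L (-(Ring.inverse (u : R) * N * Ring.inverse (u : R)))) 0 := by
  have hlin : HasDerivAt (fun ε : ℝ => (u : R) + ε • N) N 0 := by
    simpa using ((hasDerivAt_id (0 : ℝ)).smul_const N).const_add (u : R)
  have hinv := (hasFDerivAt_ringInverse (𝕜 := ℝ) u).comp_hasDerivAt_of_eq (0 : ℝ) hlin (by simp)
  simpa [Function.comp_def] using L.hasFDerivAt.comp_hasDerivAt (0 : ℝ) hinv

/-- The entries of the inverse of an affine matrix-valued function are differentiable at `0`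
if the value there is invertible. -/
theorem hasDerivAt_inv_add_smul_apply {m : ℕ} {W : Matrix (Fin m) (Fin m) ℝ} (hW : IsUnit W)
    (N : Matrix (Fin m) (Fin m) ℝ) (i j : Fin m) :
    HasDerivAt (fun ε : ℝ => (W + ε • N)⁻¹ i j) ((-(W⁻¹ * N * W⁻¹)) i j) 0 := by
  obtain ⟨u, rfl⟩ := hW
  simp only [Matrix.nonsing_inv_eq_ringInverse]
  exact @hasDerivAt_clm_ringInverse_add_smul _ Matrix.linftyOpNormedRing
    Matrix.linftyOpNormedAlgebra (inferInstanceAs (CompleteSpace (Fin m → Fin m → ℝ))) u N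
    (LinearMap.toContinuousLinearMap (Matrix.entryLinearMap ℝ ℝ i j))

/-- The derivative of the inverse along an affine line of matrices. -/
theorem hasDerivAt_inv_add_smul {m : ℕ} {W : Matrix (Fin m) (Fin m) ℝ} (hW : IsUnit W)
    (N : Matrix (Fin m) (Fin m) ℝ) :
    HasDerivAt (fun ε : ℝ => (W + ε • N)⁻¹) (-(W⁻¹ * N * W⁻¹)) 0 :=
  hasDerivAt_pi.2 fun i => hasDerivAt_pi.2 fun j => hasDerivAt_inv_add_smul_apply hW N i j

/-- The derivative of an affine line of matrices. -/
theorem hasDerivAt_add_smul {k l : ℕ} (C D : Matrix (Fin k) (Fin l) ℝ) :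
    HasDerivAt (fun ε : ℝ => C + ε • D) D 0 := by
  refine hasDerivAt_pi.2 fun i => hasDerivAt_pi.2 fun j => ?_
  simpa using ((hasDerivAt_id (0 : ℝ)).mul_const (D i j)).const_add (C i j)

/-- the map `ε ↦ R(P + εX)` is differentiable at `ε = 0` with derivative
`-X + (A + BK)ᵀ X (A + BK)` where `K = K(P)`; equivalently
`R′(P, X) = -X + (A + BK(P))ᵀ X (A + BK(P))`. -/
theorem stmt0 {n m : ℕ}
    (A : Matrix (Fin n) (Fin n) ℝ) (B : Matrix (Fin n) (Fin m) ℝ)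
    (Qxx : Matrix (Fin n) (Fin n) ℝ) (Qxu : Matrix (Fin n) (Fin m) ℝ)
    (Quu : Matrix (Fin m) (Fin m) ℝ)
    (hQxx : Qxxᵀ = Qxx) (hQuu : Quuᵀ = Quu)
    (P X : Matrix (Fin n) (Fin n) ℝ) (hP : Pᵀ = P) (hX : Xᵀ = X)
    (hinv : IsUnit (Quu + Bᵀ * P * B))
    (K : Matrix (Fin m) (Fin n) ℝ) (hK : K = gainK A B Qxuᵀ Quu P) :
    HasDerivAt (fun ε : ℝ => Ricc A B Qxx Qxu Qxuᵀ Quu (P + ε • X))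
        (-X + (A + B * K)ᵀ * X * (A + B * K)) 0 ∧
      RiccDer A B Qxx Qxu Qxuᵀ Quu P X = -X + (A + B * K)ᵀ * X * (A + B * K) := by
  have key : HasDerivAt (fun ε : ℝ => Ricc A B Qxx Qxu Qxuᵀ Quu (P + ε • X))
      (-X + (A + B * K)ᵀ * X * (A + B * K)) 0 := by
    have hS : (Quu + Bᵀ * P * B)⁻¹ᵀ = (Quu + Bᵀ * P * B)⁻¹ := by
      rw [Matrix.transpose_nonsing_inv]
      simp [hQuu, hP, Matrix.mul_assoc]
    have hKt : Kᵀ = -((Qxu + Aᵀ * P * B) * (Quu + Bᵀ * P * B)⁻¹) := by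
      rw [hK, gainK, Matrix.transpose_mul, Matrix.transpose_neg, hS]
      simp [hP, Matrix.mul_assoc]
    have hline : (fun ε : ℝ => Ricc A B Qxx Qxu Qxuᵀ Quu (P + ε • X)) = fun ε : ℝ =>
        (-P + Qxx + Aᵀ * P * A + ε • (-X + Aᵀ * X * A)) -
          (Qxu + Aᵀ * P * B + ε • (Aᵀ * X * B)) *
            (Quu + Bᵀ * P * B + ε • (Bᵀ * X * B))⁻¹ *
            (Qxuᵀ + Bᵀ * P * A + ε • (Bᵀ * X * A)) := by
      funext ε
      simp only [Ricc, Matrix.mul_add, Matrix.add_mul _ _ A, Matrix.add_mul _ _ B,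
        Matrix.mul_smul, Matrix.smul_mul, smul_add, smul_neg, neg_add, ← add_assoc]
      abel
    rw [hline]
    refine ((hasDerivAt_add_smul _ _).fun_sub
      (((hasDerivAt_add_smul _ _).matrix_mul_rect
        (hasDerivAt_inv_add_smul hinv _)).matrix_mul_rect
        (hasDerivAt_add_smul _ _))).congr_deriv ?_
    rw [Matrix.transpose_add, Matrix.transpose_mul, hKt, hK, gainK]
    simp only [zero_smul, add_zero]
    generalize (Quu + Bᵀ * P * B)⁻¹ = S
    generalize Qxu + Aᵀ * P * B = U
    generalize Qxuᵀ + Bᵀ * P * A = V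
    simp only [Matrix.mul_add, Matrix.add_mul, Matrix.neg_mul, Matrix.mul_neg,
      Matrix.mul_assoc]
    abel
  exact ⟨key, key.deriv⟩
end

section
/- Let P and X be symmetric n×n real matrices such that both Q_uu + BᵀPB and Q_uu + BᵀXB are invertible, and set K = K(P), L = K(X). Then R(P) - R′(X, P) = [I;K]ᵀ Q [I;K] + (A + BK)ᵀ P (A + BK) - (A + BL)ᵀ P (A + BL), where R′(X, P) denotes the directional derivative of the Riccati operator at X in direction P. -/
open Matrix

attribute [local instance] Matrix.normedAddCommGroup Matrix.normedSpace

/-- The stacked matrix `[I; K] ∈ ℝ^{(n+m)×n}`. -/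
def stackIK {n m : ℕ} (K : Matrix (Fin m) (Fin n) ℝ) : Matrix (Fin n ⊕ Fin m) (Fin n) ℝ :=
  fromRows (1 : Matrix (Fin n) (Fin n) ℝ) K

theorem stackIK_quadratic {n m : ℕ} (Qxx : Matrix (Fin n) (Fin n) ℝ)
    (Qxu : Matrix (Fin n) (Fin m) ℝ) (Qux : Matrix (Fin m) (Fin n) ℝ)
    (Quu : Matrix (Fin m) (Fin m) ℝ) (L : Matrix (Fin m) (Fin n) ℝ) :
    (stackIK L)ᵀ * fromBlocks Qxx Qxu Qux Quu * stackIK L =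
      Qxx + Lᵀ * Qux + (Qxu * L + Lᵀ * Quu * L) := by
  simp [stackIK, transpose_fromRows, fromCols_mul_fromBlocks, fromCols_mul_fromRows,
    Matrix.add_mul]

/-- Completion of squares for the Riccati operator, around an arbitrary gain `L`. -/
theorem ricc_eq_completed_square {n m : ℕ}
    (A : Matrix (Fin n) (Fin n) ℝ) (B : Matrix (Fin n) (Fin m) ℝ)
    (Qxx : Matrix (Fin n) (Fin n) ℝ) (Qxu : Matrix (Fin n) (Fin m) ℝ)
    (Quu : Matrix (Fin m) (Fin m) ℝ) (hQuu : Quuᵀ = Quu)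
    (Y : Matrix (Fin n) (Fin n) ℝ) (hY : Yᵀ = Y) (hS : IsUnit (Quu + Bᵀ * Y * B))
    (L : Matrix (Fin m) (Fin n) ℝ) :
    Ricc A B Qxx Qxu Qxuᵀ Quu Y =
      -Y + (stackIK L)ᵀ * fromBlocks Qxx Qxu Qxuᵀ Quu * stackIK L
        + (A + B * L)ᵀ * Y * (A + B * L)
        - ((Quu + Bᵀ * Y * B) * L + (Qxuᵀ + Bᵀ * Y * A))ᵀ * (Quu + Bᵀ * Y * B)⁻¹ *
          ((Quu + Bᵀ * Y * B) * L + (Qxuᵀ + Bᵀ * Y * A)) := by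
  have hST : (Quu + Bᵀ * Y * B)ᵀ = Quu + Bᵀ * Y * B := by
    simp [hQuu, hY, Matrix.mul_assoc]
  have hNT : (Qxuᵀ + Bᵀ * Y * A)ᵀ = Qxu + Aᵀ * Y * B := by
    simp [hY, Matrix.mul_assoc]
  have hdet := (Matrix.isUnit_iff_isUnit_det _).1 hS
  have key : ((Quu + Bᵀ * Y * B) * L + (Qxuᵀ + Bᵀ * Y * A))ᵀ * (Quu + Bᵀ * Y * B)⁻¹ *
        ((Quu + Bᵀ * Y * B) * L + (Qxuᵀ + Bᵀ * Y * A)) =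
      Lᵀ * (Quu + Bᵀ * Y * B) * L + Lᵀ * (Qxuᵀ + Bᵀ * Y * A) + (Qxu + Aᵀ * Y * B) * L
        + (Qxu + Aᵀ * Y * B) * (Quu + Bᵀ * Y * B)⁻¹ * (Qxuᵀ + Bᵀ * Y * A) := by
    rw [transpose_add, transpose_mul, hST, hNT]
    generalize Quu + Bᵀ * Y * B = S at *
    generalize Qxuᵀ + Bᵀ * Y * A = N at *
    generalize Qxu + Aᵀ * Y * B = M at *
    rw [Matrix.add_mul, Matrix.mul_nonsing_inv_cancel_right _ _ hdet, Matrix.mul_add,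
      Matrix.add_mul, Matrix.add_mul, Matrix.mul_assoc M S⁻¹ (S * L),
      Matrix.nonsing_inv_mul_cancel_left _ _ hdet, Matrix.mul_assoc Lᵀ S L]
    abel
  rw [key, stackIK_quadratic, Ricc]
  generalize (Qxu + Aᵀ * Y * B) * (Quu + Bᵀ * Y * B)⁻¹ * (Qxuᵀ + Bᵀ * Y * A) = Z
  simp only [transpose_add, transpose_mul, Matrix.add_mul, Matrix.mul_add, Matrix.mul_assoc]
  abel

theorem mul_gainK_add {n m : ℕ}
    (A : Matrix (Fin n) (Fin n) ℝ) (B : Matrix (Fin n) (Fin m) ℝ)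
    (Qux : Matrix (Fin m) (Fin n) ℝ) (Quu : Matrix (Fin m) (Fin m) ℝ)
    (P : Matrix (Fin n) (Fin n) ℝ) (hS : IsUnit (Quu + Bᵀ * P * B)) :
    (Quu + Bᵀ * P * B) * gainK A B Qux Quu P + (Qux + Bᵀ * P * A) = 0 := by
  rw [gainK, Matrix.neg_mul, Matrix.mul_neg,
    Matrix.mul_nonsing_inv_cancel_left _ _ ((Matrix.isUnit_iff_isUnit_det _).1 hS),
    neg_add_cancel]

/-- At the optimal gain the completed square vanishes. -/
theorem ricc_eq_gainK {n m : ℕ}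
    (A : Matrix (Fin n) (Fin n) ℝ) (B : Matrix (Fin n) (Fin m) ℝ)
    (Qxx : Matrix (Fin n) (Fin n) ℝ) (Qxu : Matrix (Fin n) (Fin m) ℝ)
    (Quu : Matrix (Fin m) (Fin m) ℝ) (hQuu : Quuᵀ = Quu)
    (P : Matrix (Fin n) (Fin n) ℝ) (hP : Pᵀ = P) (hS : IsUnit (Quu + Bᵀ * P * B)) :
    Ricc A B Qxx Qxu Qxuᵀ Quu P =
      -P + (stackIK (gainK A B Qxuᵀ Quu P))ᵀ * fromBlocks Qxx Qxu Qxuᵀ Quu *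
          stackIK (gainK A B Qxuᵀ Quu P)
        + (A + B * gainK A B Qxuᵀ Quu P)ᵀ * P * (A + B * gainK A B Qxuᵀ Quu P) := by
  rw [ricc_eq_completed_square A B Qxx Qxu Quu hQuu P hP hS (gainK A B Qxuᵀ Quu P),
    mul_gainK_add A B Qxuᵀ Quu P hS, Matrix.mul_zero, sub_zero]

/-- Exact second-order expansion of the Riccati operator along a line. -/
theorem ricc_add_smul {n m : ℕ}
    (A : Matrix (Fin n) (Fin n) ℝ) (B : Matrix (Fin n) (Fin m) ℝ)
    (Qxx : Matrix (Fin n) (Fin n) ℝ) (Qxu : Matrix (Fin n) (Fin m) ℝ)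
    (Quu : Matrix (Fin m) (Fin m) ℝ) (hQuu : Quuᵀ = Quu)
    (P X : Matrix (Fin n) (Fin n) ℝ) (hP : Pᵀ = P) (hX : Xᵀ = X)
    (hinvX : IsUnit (Quu + Bᵀ * X * B))
    (L : Matrix (Fin m) (Fin n) ℝ) (hL : L = gainK A B Qxuᵀ Quu X)
    (ε : ℝ) (hε : IsUnit (Quu + Bᵀ * (X + ε • P) * B)) :
    Ricc A B Qxx Qxu Qxuᵀ Quu (X + ε • P) =
      Ricc A B Qxx Qxu Qxuᵀ Quu X + ε • (-P + (A + B * L)ᵀ * P * (A + B * L))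
        - ε ^ 2 • ((Bᵀ * P * (A + B * L))ᵀ * (Quu + Bᵀ * (X + ε • P) * B)⁻¹ *
          (Bᵀ * P * (A + B * L))) := by
  have hW : (Quu + Bᵀ * (X + ε • P) * B) * L + (Qxuᵀ + Bᵀ * (X + ε • P) * A) =
      ε • (Bᵀ * P * (A + B * L)) := by
    have h := mul_gainK_add A B Qxuᵀ Quu X hinvX
    rw [← hL] at h
    rw [← add_zero (ε • (Bᵀ * P * (A + B * L))), ← h]
    simp only [Matrix.add_mul, Matrix.mul_add, Matrix.mul_assoc, Matrix.smul_mul,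
      Matrix.mul_smul, smul_add]
    abel
  have hY : (X + ε • P)ᵀ = X + ε • P := by simp [hP, hX]
  rw [ricc_eq_completed_square A B Qxx Qxu Quu hQuu _ hY hε L, hW,
    ricc_eq_gainK A B Qxx Qxu Quu hQuu X hX hinvX, ← hL]
  generalize (Quu + Bᵀ * (X + ε • P) * B)⁻¹ = T
  generalize Bᵀ * P * (A + B * L) = W
  generalize A + B * L = C
  generalize (stackIK L)ᵀ * fromBlocks Qxx Qxu Qxuᵀ Quu * stackIK L = Z
  simp only [transpose_smul, Matrix.add_mul, Matrix.mul_add, Matrix.smul_mul,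
    Matrix.mul_smul, smul_add, smul_neg, smul_smul, neg_add, pow_two]
  abel

theorem hasDerivAt_ricc {n m : ℕ}
    (A : Matrix (Fin n) (Fin n) ℝ) (B : Matrix (Fin n) (Fin m) ℝ)
    (Qxx : Matrix (Fin n) (Fin n) ℝ) (Qxu : Matrix (Fin n) (Fin m) ℝ)
    (Quu : Matrix (Fin m) (Fin m) ℝ) (hQuu : Quuᵀ = Quu)
    (P X : Matrix (Fin n) (Fin n) ℝ) (hP : Pᵀ = P) (hX : Xᵀ = X)
    (hinvX : IsUnit (Quu + Bᵀ * X * B))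
    (L : Matrix (Fin m) (Fin n) ℝ) (hL : L = gainK A B Qxuᵀ Quu X) :
    HasDerivAt (fun ε : ℝ => Ricc A B Qxx Qxu Qxuᵀ Quu (X + ε • P))
      (-P + (A + B * L)ᵀ * P * (A + B * L)) 0 := by
  have hScont : Continuous fun ε : ℝ => Quu + Bᵀ * (X + ε • P) * B := by fun_prop
  have hdet0 : (Quu + Bᵀ * (X + (0 : ℝ) • P) * B).det ≠ 0 := by
    simpa using ((Matrix.isUnit_iff_isUnit_det _).1 hinvX).ne_zero
  have hev : ∀ᶠ ε : ℝ in nhds 0, IsUnit (Quu + Bᵀ * (X + ε • P) * B) := by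
    filter_upwards [hScont.matrix_det.continuousAt.eventually_ne hdet0] with ε h
    exact (Matrix.isUnit_iff_isUnit_det _).2 h.isUnit
  have hinv : ContinuousAt (fun ε : ℝ => (Quu + Bᵀ * (X + ε • P) * B)⁻¹) 0 := by
    simp only [Matrix.inv_def, Ring.inverse_eq_inv']
    exact (hScont.matrix_det.continuousAt.inv₀ hdet0).smul hScont.matrix_adjugate.continuousAt
  have hT : ContinuousAt (fun ε : ℝ => (-P + (A + B * L)ᵀ * P * (A + B * L)) -
      ε • ((Bᵀ * P * (A + B * L))ᵀ * (Quu + Bᵀ * (X + ε • P) * B)⁻¹ *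
          (Bᵀ * P * (A + B * L)))) 0 := by
    have h := ((continuous_const (y := (Bᵀ * P * (A + B * L))ᵀ)).matrix_mul
      continuous_id).matrix_mul (continuous_const (y := Bᵀ * P * (A + B * L)))
    exact continuousAt_const.sub (continuousAt_id.smul (h.continuousAt.comp hinv))
  refine hasDerivAt_iff_tendsto_slope.2 ?_
  have hlim := hT.tendsto
  rw [zero_smul, sub_zero] at hlim
  refine (hlim.mono_left nhdsWithin_le_nhds).congr' ?_
  filter_upwards [nhdsWithin_le_nhds hev, self_mem_nhdsWithin] with ε hε hne
  have hne : ε ≠ 0 := hne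
  rw [slope_def_module, zero_smul, add_zero, sub_zero,
    ricc_add_smul A B Qxx Qxu Quu hQuu P X hP hX hinvX L hL ε hε, sub_right_comm,
    add_sub_cancel_left, smul_sub, smul_smul, smul_smul, inv_mul_cancel₀ hne, one_smul,
    pow_two, inv_mul_cancel_left₀ hne]

/-- `R(P) - R′(X, P) = [I;K]ᵀ Q [I;K] + (A+BK)ᵀP(A+BK) - (A+BL)ᵀP(A+BL)`
where `K = K(P)` and `L = K(X)`. -/
theorem stmt3 {n m : ℕ}
    (A : Matrix (Fin n) (Fin n) ℝ) (B : Matrix (Fin n) (Fin m) ℝ)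
    (Qxx : Matrix (Fin n) (Fin n) ℝ) (Qxu : Matrix (Fin n) (Fin m) ℝ)
    (Quu : Matrix (Fin m) (Fin m) ℝ)
    (hQxx : Qxxᵀ = Qxx) (hQuu : Quuᵀ = Quu)
    (Q : Matrix (Fin n ⊕ Fin m) (Fin n ⊕ Fin m) ℝ)
    (hQ : Q = fromBlocks Qxx Qxu Qxuᵀ Quu)
    (P X : Matrix (Fin n) (Fin n) ℝ) (hP : Pᵀ = P) (hX : Xᵀ = X)
    (hinvP : IsUnit (Quu + Bᵀ * P * B)) (hinvX : IsUnit (Quu + Bᵀ * X * B))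
    (K L : Matrix (Fin m) (Fin n) ℝ)
    (hK : K = gainK A B Qxuᵀ Quu P) (hL : L = gainK A B Qxuᵀ Quu X) :
    Ricc A B Qxx Qxu Qxuᵀ Quu P - RiccDer A B Qxx Qxu Qxuᵀ Quu X P =
      (stackIK K)ᵀ * Q * stackIK K + (A + B * K)ᵀ * P * (A + B * K) -
        (A + B * L)ᵀ * P * (A + B * L) := by
  subst hK hL hQ
  have hder : RiccDer A B Qxx Qxu Qxuᵀ Quu X P = _ :=
    (hasDerivAt_ricc A B Qxx Qxu Quu hQuu P X hP hX hinvX _ rfl).deriv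
  rw [hder, ricc_eq_gainK A B Qxx Qxu Quu hQuu P hP hinvP]
  abel
end

section
/- Let P be a symmetric n×n real matrix with Q_uu + BᵀPB invertible and let K = K(P). Then R(P) - R′(P, P) = [I;K]ᵀ Q [I;K], where R′(P, P) denotes the directional derivative of the Riccati operator at P in direction P. -/
open Matrix

attribute [local instance] Matrix.normedAddCommGroup Matrix.normedSpace

/-- A quadratic remainder with a continuous coefficient has derivative zero at the origin. -/
theorem hasDerivAt_sq_smul_zero {E : Type*} [NormedAddCommGroup E] [NormedSpace ℝ E] {g : ℝ → E}
    (hg : ContinuousAt g 0) : HasDerivAt (fun ε : ℝ => ε ^ 2 • g ε) 0 0 := by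
  rw [hasDerivAt_iff_tendsto_slope_zero]
  have h : Filter.Tendsto (fun t : ℝ => t • g t) (nhdsWithin 0 {0}ᶜ) (nhds 0) := by
    have h0 : ContinuousAt (fun t : ℝ => t • g t) 0 := continuousAt_id.smul hg
    simpa [ContinuousAt] using h0.tendsto.mono_left nhdsWithin_le_nhds
  refine h.congr' ?_
  filter_upwards [self_mem_nhdsWithin] with t ht
  have ht : t ≠ 0 := ht
  simp only [zero_add, ne_eq, OfNat.ofNat_ne_zero, not_false_eq_true, zero_pow, zero_smul,
    sub_zero, smul_smul]
  congr 1
  field_simp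

theorem Matrix.continuousAt_inv_of_isUnit {X ι : Type*} [TopologicalSpace X] [Fintype ι]
    [DecidableEq ι] {S : X → Matrix ι ι ℝ} {x : X} (hS : ContinuousAt S x)
    (hx : IsUnit (S x)) : ContinuousAt (fun y => (S y)⁻¹) x := by
  have hdet : (S x).det ≠ 0 := ((Matrix.isUnit_iff_isUnit_det _).1 hx).ne_zero
  have hd : ContinuousAt (fun y => (S y).det) x :=
    (continuous_id.matrix_det (R := ℝ) (n := ι)).continuousAt.comp hS
  have ha : ContinuousAt (fun y => (S y).adjugate) x :=
    (continuous_id.matrix_adjugate (R := ℝ) (n := ι)).continuousAt.comp hS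
  simp only [Matrix.inv_def, Ring.inverse_eq_inv']
  exact (hd.inv₀ hdet).smul ha

/-- Completion of the square around an arbitrary pair of gains. -/
theorem Matrix.mul_inv_mul_eq_complete_square {n m : ℕ} (N L : Matrix (Fin n) (Fin m) ℝ)
    (M K : Matrix (Fin m) (Fin n) ℝ) (S : Matrix (Fin m) (Fin m) ℝ) (hS : IsUnit S) :
    N * S⁻¹ * M = (N + L * S) * S⁻¹ * (M + S * K) - (N * K + L * M + L * S * K) := by
  have hdet := (Matrix.isUnit_iff_isUnit_det _).1 hS
  rw [Matrix.add_mul N, Matrix.mul_nonsing_inv_cancel_right _ _ hdet, Matrix.add_mul,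
    Matrix.mul_add, Matrix.mul_add, ← Matrix.mul_assoc (N * S⁻¹) S K,
    Matrix.nonsing_inv_mul_cancel_right _ _ hdet, ← Matrix.mul_assoc L S K]
  abel

/-- The derivative of the Riccati operator is the closed-loop Lyapunov operator. -/
theorem hasDerivAt_Ricc {n m : ℕ} (A : Matrix (Fin n) (Fin n) ℝ) (B : Matrix (Fin n) (Fin m) ℝ)
    (Qxx : Matrix (Fin n) (Fin n) ℝ) (Qxu : Matrix (Fin n) (Fin m) ℝ)
    (Qux : Matrix (Fin m) (Fin n) ℝ) (Quu : Matrix (Fin m) (Fin m) ℝ)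
    (P X : Matrix (Fin n) (Fin n) ℝ) (hinv : IsUnit (Quu + Bᵀ * P * B))
    (K : Matrix (Fin m) (Fin n) ℝ)
    (hM : Qux + Bᵀ * P * A + (Quu + Bᵀ * P * B) * K = 0)
    (hN : Qxu + Aᵀ * P * B + Kᵀ * (Quu + Bᵀ * P * B) = 0) :
    HasDerivAt (fun ε : ℝ => Ricc A B Qxx Qxu Qux Quu (P + ε • X))
      ((A + B * K)ᵀ * X * (A + B * K) - X) 0 := by
  set S : ℝ → Matrix (Fin m) (Fin m) ℝ := fun ε => Quu + Bᵀ * (P + ε • X) * B with hSdef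
  have hS0 : IsUnit (S 0) := by simpa [hSdef] using hinv
  have hSc : Continuous S := by
    simp only [hSdef]
    fun_prop
  have hInv : ContinuousAt (fun ε => (S ε)⁻¹) 0 :=
    Matrix.continuousAt_inv_of_isUnit hSc.continuousAt hS0
  have hev : ∀ᶠ ε in nhds (0 : ℝ), IsUnit (S ε) := by
    have hd : Continuous fun ε => (S ε).det := hSc.matrix_det
    have hne : (S 0).det ≠ 0 := ((Matrix.isUnit_iff_isUnit_det _).1 hS0).ne_zero
    filter_upwards [hd.continuousAt.eventually_ne hne] with ε hε
    exact (Matrix.isUnit_iff_isUnit_det _).2 hε.isUnit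
  set Y := Bᵀ * X * A + Bᵀ * X * B * K with hY
  set Z := Aᵀ * X * B + Kᵀ * (Bᵀ * X * B) with hZ
  have hg : ContinuousAt (fun ε => Z * (S ε)⁻¹ * Y) 0 := by
    have hc : Continuous fun T : Matrix (Fin m) (Fin m) ℝ => Z * T * Y := by fun_prop
    exact hc.continuousAt.comp hInv
  have hq := hasDerivAt_sq_smul_zero hg
  have hl : HasDerivAt (fun ε : ℝ => Ricc A B Qxx Qxu Qux Quu P +
      ε • ((A + B * K)ᵀ * X * (A + B * K) - X)) ((A + B * K)ᵀ * X * (A + B * K) - X) 0 := by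
    have h := ((hasDerivAt_id (0 : ℝ)).smul_const
      ((A + B * K)ᵀ * X * (A + B * K) - X)).const_add (Ricc A B Qxx Qxu Qux Quu P)
    rw [one_smul] at h
    exact h
  have hsub := hl.sub hq
  rw [sub_zero] at hsub
  refine hsub.congr_of_eventuallyEq ?_
  filter_upwards [hev] with ε hε
  have hMε : Qux + Bᵀ * (P + ε • X) * A + S ε * K = ε • Y := by
    rw [← add_zero (ε • Y), ← hM]
    simp only [hSdef, hY, Matrix.mul_add, Matrix.add_mul, Matrix.mul_smul, Matrix.smul_mul,
      smul_add]
    abel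
  have hNε : Qxu + Aᵀ * (P + ε • X) * B + Kᵀ * S ε = ε • Z := by
    rw [← add_zero (ε • Z), ← hN]
    simp only [hSdef, hZ, Matrix.mul_add, Matrix.add_mul, Matrix.mul_smul, Matrix.smul_mul,
      smul_add]
    abel
  simp only [Pi.sub_apply, Ricc]
  rw [Matrix.mul_inv_mul_eq_complete_square _ Kᵀ _ K _ hε,
    Matrix.mul_inv_mul_eq_complete_square _ Kᵀ _ K _ hinv, hM, hN, hMε, hNε]
  simp only [hSdef, Matrix.mul_add, Matrix.add_mul, Matrix.mul_smul, Matrix.smul_mul, smul_add,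
    Matrix.transpose_add, Matrix.transpose_mul, smul_smul, smul_sub, Matrix.mul_assoc,
    Matrix.mul_zero, Matrix.zero_mul, pow_two]
  abel

/-- `R(P) - R′(P, P) = [I;K]ᵀ Q [I;K]` where `K = K(P)`. -/
theorem stmt4 {n m : ℕ}
    (A : Matrix (Fin n) (Fin n) ℝ) (B : Matrix (Fin n) (Fin m) ℝ)
    (Qxx : Matrix (Fin n) (Fin n) ℝ) (Qxu : Matrix (Fin n) (Fin m) ℝ)
    (Quu : Matrix (Fin m) (Fin m) ℝ)
    (hQxx : Qxxᵀ = Qxx) (hQuu : Quuᵀ = Quu)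
    (Q : Matrix (Fin n ⊕ Fin m) (Fin n ⊕ Fin m) ℝ)
    (hQ : Q = fromBlocks Qxx Qxu Qxuᵀ Quu)
    (P : Matrix (Fin n) (Fin n) ℝ) (hP : Pᵀ = P)
    (hinv : IsUnit (Quu + Bᵀ * P * B))
    (K : Matrix (Fin m) (Fin n) ℝ) (hK : K = gainK A B Qxuᵀ Quu P) :
    Ricc A B Qxx Qxu Qxuᵀ Quu P - RiccDer A B Qxx Qxu Qxuᵀ Quu P P =
      (stackIK K)ᵀ * Q * stackIK K := by
  have hdet := (Matrix.isUnit_iff_isUnit_det _).1 hinv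
  have hM : Qxuᵀ + Bᵀ * P * A + (Quu + Bᵀ * P * B) * K = 0 := by
    rw [hK, gainK, Matrix.neg_mul, Matrix.mul_neg, Matrix.mul_nonsing_inv_cancel_left _ _ hdet,
      add_neg_cancel]
  have hN : Qxu + Aᵀ * P * B + Kᵀ * (Quu + Bᵀ * P * B) = 0 := by
    have h := congrArg Matrix.transpose hM
    simpa only [Matrix.transpose_add, Matrix.transpose_mul, Matrix.transpose_transpose, hP, hQuu,
      Matrix.transpose_zero, Matrix.mul_assoc] using h
  have hD : RiccDer A B Qxx Qxu Qxuᵀ Quu P P = (A + B * K)ᵀ * P * (A + B * K) - P :=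
    (hasDerivAt_Ricc A B Qxx Qxu Qxuᵀ Quu P P hinv K hM hN).deriv
  rw [hD, Ricc,
    Matrix.mul_inv_mul_eq_complete_square _ Kᵀ _ K _ hinv, hM, hN, hQ, stackIK,
    Matrix.transpose_fromRows, Matrix.fromCols_mul_fromBlocks, Matrix.fromCols_mul_fromRows]
  simp only [Matrix.mul_add, Matrix.add_mul, Matrix.transpose_add, Matrix.transpose_mul,
    Matrix.mul_assoc, Matrix.mul_zero, Matrix.transpose_one, Matrix.one_mul, Matrix.mul_one]
  abel
end

section
/- (Wonham-type identity.) Let K ∈ ℝ^{m×n} and let P be a symmetric n×n real matrix satisfying the Lyapunov equation P = (A + BK)ᵀ P (A + BK) + [I;K]ᵀ Q [I;K], and suppose Q_uu + BᵀPB is invertible. Set K^N = K(P). Then P = (A + BK^N)ᵀ P (A + BK^N) + [I;K^N]ᵀ Q [I;K^N] + (K - K^N)ᵀ (Q_uu + BᵀPB) (K - K^N). -/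
open Matrix

theorem stackIK_transpose_mul_fromBlocks_mul {n m : ℕ} (Qxx : Matrix (Fin n) (Fin n) ℝ)
    (Qxu : Matrix (Fin n) (Fin m) ℝ) (Quu : Matrix (Fin m) (Fin m) ℝ)
    (K : Matrix (Fin m) (Fin n) ℝ) :
    (stackIK K)ᵀ * fromBlocks Qxx Qxu Qxuᵀ Quu * stackIK K =
      Qxx + Kᵀ * Qxuᵀ + Qxu * K + Kᵀ * Quu * K := by
  simp only [stackIK, transpose_fromRows, fromCols_mul_fromBlocks, fromCols_mul_fromRows,
    transpose_one, Matrix.one_mul, Matrix.mul_one, Matrix.add_mul]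
  abel

/-- The policy-evaluation operator as a quadratic function of the gain. -/
theorem lyapunov_eq_quadratic {n m : ℕ} (A : Matrix (Fin n) (Fin n) ℝ)
    (B : Matrix (Fin n) (Fin m) ℝ) (Qxx : Matrix (Fin n) (Fin n) ℝ)
    (Qxu : Matrix (Fin n) (Fin m) ℝ) (Quu : Matrix (Fin m) (Fin m) ℝ)
    (P : Matrix (Fin n) (Fin n) ℝ) (hP : Pᵀ = P) (K : Matrix (Fin m) (Fin n) ℝ) :
    (A + B * K)ᵀ * P * (A + B * K) +
        (stackIK K)ᵀ * fromBlocks Qxx Qxu Qxuᵀ Quu * stackIK K =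
      Aᵀ * P * A + Qxx + Kᵀ * (Qxuᵀ + Bᵀ * P * A) + (Qxuᵀ + Bᵀ * P * A)ᵀ * K +
        Kᵀ * (Quu + Bᵀ * P * B) * K := by
  rw [stackIK_transpose_mul_fromBlocks_mul]
  simp only [transpose_add, transpose_mul, transpose_transpose, hP, Matrix.add_mul,
    Matrix.mul_add, Matrix.mul_assoc]
  abel

theorem mul_gainK {n m : ℕ} (A : Matrix (Fin n) (Fin n) ℝ) (B : Matrix (Fin n) (Fin m) ℝ)
    (Qux : Matrix (Fin m) (Fin n) ℝ) (Quu : Matrix (Fin m) (Fin m) ℝ)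
    (P : Matrix (Fin n) (Fin n) ℝ) (hinv : IsUnit (Quu + Bᵀ * P * B)) :
    (Quu + Bᵀ * P * B) * gainK A B Qux Quu P = -(Qux + Bᵀ * P * A) := by
  rw [gainK, Matrix.neg_mul, Matrix.mul_neg,
    mul_nonsing_inv_cancel_left _ _ ((isUnit_iff_isUnit_det _).mp hinv)]

/-- Wonham-type identity: if `P` solves the policy-evaluation Lyapunov equation
for the gain `K` and `K^N = K(P)`, then
`P = (A+BK^N)ᵀ P (A+BK^N) + [I;K^N]ᵀ Q [I;K^N] + (K-K^N)ᵀ (Q_uu + BᵀPB) (K-K^N)`. -/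
theorem stmt6 {n m : ℕ}
    (A : Matrix (Fin n) (Fin n) ℝ) (B : Matrix (Fin n) (Fin m) ℝ)
    (Qxx : Matrix (Fin n) (Fin n) ℝ) (Qxu : Matrix (Fin n) (Fin m) ℝ)
    (Quu : Matrix (Fin m) (Fin m) ℝ)
    (hQxx : Qxxᵀ = Qxx) (hQuu : Quuᵀ = Quu)
    (Q : Matrix (Fin n ⊕ Fin m) (Fin n ⊕ Fin m) ℝ)
    (hQ : Q = fromBlocks Qxx Qxu Qxuᵀ Quu)
    (K : Matrix (Fin m) (Fin n) ℝ)
    (P : Matrix (Fin n) (Fin n) ℝ) (hP : Pᵀ = P)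
    (hLyap : P = (A + B * K)ᵀ * P * (A + B * K) + (stackIK K)ᵀ * Q * stackIK K)
    (hinv : IsUnit (Quu + Bᵀ * P * B))
    (KN : Matrix (Fin m) (Fin n) ℝ) (hKN : KN = gainK A B Qxuᵀ Quu P) :
    P = (A + B * KN)ᵀ * P * (A + B * KN) + (stackIK KN)ᵀ * Q * stackIK KN +
        (K - KN)ᵀ * (Quu + Bᵀ * P * B) * (K - KN) := by
  have hS : Qxuᵀ + Bᵀ * P * A = -((Quu + Bᵀ * P * B) * KN) := by
    rw [hKN, mul_gainK A B Qxuᵀ Quu P hinv, neg_neg]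
  have hR : (Quu + Bᵀ * P * B)ᵀ = Quu + Bᵀ * P * B := by
    simp only [transpose_add, transpose_mul, transpose_transpose, hP, hQuu, Matrix.mul_assoc]
  rw [hQ, lyapunov_eq_quadratic A B Qxx Qxu Quu P hP, hS] at hLyap
  rw [hQ, lyapunov_eq_quadratic A B Qxx Qxu Quu P hP, hS]
  refine hLyap.trans ?_
  generalize Quu + Bᵀ * P * B = R at hR
  simp only [transpose_neg, transpose_mul, transpose_sub, hR, Matrix.sub_mul, Matrix.mul_sub,
    Matrix.neg_mul, Matrix.mul_neg, Matrix.mul_assoc]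
  abel
end

section
/- (Midpoint Newton equation as a Lyapunov equation.) Let P and M be symmetric n×n real matrices with Q_uu + BᵀPB and Q_uu + BᵀMB invertible, and set K = K(P), L = K(M). A symmetric matrix X satisfies the midpoint Newton equation R′(M, X - P) = -R(P) (with R′ the directional derivative of the Riccati operator) if and only if X satisfies the Lyapunov equation X = (A + BL)ᵀ X (A + BL) + [I;K]ᵀ Q [I;K] + (A + BK)ᵀ P (A + BK) - (A + BL)ᵀ P (A + BL). -/
open Matrix

attribute [local instance] Matrix.normedAddCommGroup Matrix.normedSpace

/-- Completing the square in the Riccati operator around an arbitrary gain `L`. -/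
theorem Ricc_eq_sub_square {n m : ℕ}
    (A : Matrix (Fin n) (Fin n) ℝ) (B : Matrix (Fin n) (Fin m) ℝ)
    (Qxx : Matrix (Fin n) (Fin n) ℝ) (Qxu : Matrix (Fin n) (Fin m) ℝ)
    (Quu : Matrix (Fin m) (Fin m) ℝ) (hQuu : Quuᵀ = Quu)
    (P : Matrix (Fin n) (Fin n) ℝ) (hP : Pᵀ = P) (hinv : IsUnit (Quu + Bᵀ * P * B))
    (L : Matrix (Fin m) (Fin n) ℝ) :
    Ricc A B Qxx Qxu Qxuᵀ Quu P =
      -P + (stackIK L)ᵀ * fromBlocks Qxx Qxu Qxuᵀ Quu * stackIK L +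
        (A + B * L)ᵀ * P * (A + B * L) -
        (Qxuᵀ + Bᵀ * P * A + (Quu + Bᵀ * P * B) * L)ᵀ * (Quu + Bᵀ * P * B)⁻¹ *
          (Qxuᵀ + Bᵀ * P * A + (Quu + Bᵀ * P * B) * L) := by
  have hstack : (stackIK L)ᵀ * fromBlocks Qxx Qxu Qxuᵀ Quu * stackIK L =
      Qxx + Lᵀ * Qxuᵀ + (Qxu + Lᵀ * Quu) * L := by
    simp [stackIK, transpose_fromRows, fromCols_mul_fromBlocks, fromCols_mul_fromRows]
  rw [hstack, Ricc]
  have hdet := (isUnit_iff_isUnit_det _).mp hinv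
  have hN : (Qxuᵀ + Bᵀ * P * A)ᵀ = Qxu + Aᵀ * P * B := by
    simp [transpose_mul, hP, Matrix.mul_assoc]
  have hS : (Quu + Bᵀ * P * B)ᵀ = Quu + Bᵀ * P * B := by
    simp [transpose_mul, hP, hQuu, Matrix.mul_assoc]
  have hsquare : (Qxuᵀ + Bᵀ * P * A + (Quu + Bᵀ * P * B) * L)ᵀ * (Quu + Bᵀ * P * B)⁻¹ *
        (Qxuᵀ + Bᵀ * P * A + (Quu + Bᵀ * P * B) * L) =
      (Qxu + Aᵀ * P * B) * (Quu + Bᵀ * P * B)⁻¹ * (Qxuᵀ + Bᵀ * P * A) +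
        (Qxu + Aᵀ * P * B) * L + Lᵀ * (Qxuᵀ + Bᵀ * P * A) +
        Lᵀ * (Quu + Bᵀ * P * B) * L := by
    rw [transpose_add, transpose_mul, hN, hS]
    generalize Quu + Bᵀ * P * B = S at hdet
    rw [Matrix.add_mul, mul_nonsing_inv_cancel_right _ _ hdet, Matrix.add_mul, Matrix.mul_add,
      Matrix.mul_add Lᵀ _ (S * L), Matrix.mul_assoc _ S⁻¹ (S * L), nonsing_inv_mul_cancel_left _ _ hdet,
      ← Matrix.mul_assoc Lᵀ S L]
    abel
  rw [hsquare]
  simp only [transpose_add, transpose_mul, Matrix.add_mul, Matrix.mul_add, Matrix.mul_assoc]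
  abel

theorem gainK_residual {n m : ℕ}
    (A : Matrix (Fin n) (Fin n) ℝ) (B : Matrix (Fin n) (Fin m) ℝ)
    (Qux : Matrix (Fin m) (Fin n) ℝ) (Quu : Matrix (Fin m) (Fin m) ℝ)
    (P : Matrix (Fin n) (Fin n) ℝ) (hinv : IsUnit (Quu + Bᵀ * P * B)) :
    Qux + Bᵀ * P * A + (Quu + Bᵀ * P * B) * gainK A B Qux Quu P = 0 := by
  rw [gainK, Matrix.neg_mul, Matrix.mul_neg,
    mul_nonsing_inv_cancel_left _ _ ((isUnit_iff_isUnit_det _).mp hinv), add_neg_cancel]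

/-- The derivative of the Riccati operator is the closed-loop Lyapunov operator. -/
theorem RiccDer_eq {n m : ℕ}
    (A : Matrix (Fin n) (Fin n) ℝ) (B : Matrix (Fin n) (Fin m) ℝ)
    (Qxx : Matrix (Fin n) (Fin n) ℝ) (Qxu : Matrix (Fin n) (Fin m) ℝ)
    (Quu : Matrix (Fin m) (Fin m) ℝ) (hQuu : Quuᵀ = Quu)
    (M D : Matrix (Fin n) (Fin n) ℝ) (hM : Mᵀ = M) (hD : Dᵀ = D)
    (hinv : IsUnit (Quu + Bᵀ * M * B)) :
    RiccDer A B Qxx Qxu Qxuᵀ Quu M D =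
      -D + (A + B * gainK A B Qxuᵀ Quu M)ᵀ * D * (A + B * gainK A B Qxuᵀ Quu M) := by
  set L := gainK A B Qxuᵀ Quu M with hL
  set F := A + B * L with hF
  set S : ℝ → Matrix (Fin m) (Fin m) ℝ := fun ε => Quu + Bᵀ * (M + ε • D) * B with hS
  have hScont : Continuous S := by fun_prop
  have hS0 : S 0 = Quu + Bᵀ * M * B := by simp [hS]
  have hdet0 : (S 0).det ≠ 0 := by
    rw [hS0]
    exact ((isUnit_iff_isUnit_det _).mp hinv).ne_zero
  have hev : ∀ᶠ ε in nhds (0 : ℝ), (S ε).det ≠ 0 :=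
    hScont.matrix_det.continuousAt.eventually_ne hdet0
  have hSinv : ContinuousAt (fun ε => (S ε)⁻¹) 0 := by
    simp only [inv_def, Ring.inverse_eq_inv]
    exact (hScont.matrix_det.continuousAt.inv₀ hdet0).smul
      hScont.matrix_adjugate.continuousAt
  have hexp : ∀ ε, (S ε).det ≠ 0 → Ricc A B Qxx Qxu Qxuᵀ Quu (M + ε • D) =
      Ricc A B Qxx Qxu Qxuᵀ Quu M +
        ε • (-D + Fᵀ * D * F - ε • ((Bᵀ * D * F)ᵀ * (S ε)⁻¹ * (Bᵀ * D * F))) := by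
    intro ε hε
    have hres : Qxuᵀ + Bᵀ * (M + ε • D) * A + (Quu + Bᵀ * (M + ε • D) * B) * L =
        ε • (Bᵀ * D * F) := by
      have h0 := gainK_residual A B Qxuᵀ Quu M hinv
      rw [← hL] at h0
      rw [← zero_add (ε • (Bᵀ * D * F)), ← h0, hF]
      simp only [Matrix.add_mul, Matrix.mul_add, Matrix.mul_smul, Matrix.smul_mul, smul_add,
        Matrix.mul_assoc]
      abel
    rw [Ricc_eq_sub_square A B Qxx Qxu Quu hQuu (M + ε • D) (by simp [hM, hD])
        ((isUnit_iff_isUnit_det _).mpr hε.isUnit) L, hres,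
      Ricc_eq_sub_square A B Qxx Qxu Quu hQuu M hM hinv L,
      gainK_residual A B Qxuᵀ Quu M hinv, ← hF]
    change _ - (ε • (Bᵀ * D * F))ᵀ * (S ε)⁻¹ * (ε • (Bᵀ * D * F)) = _
    simp only [transpose_smul, Matrix.add_mul, Matrix.mul_add, Matrix.mul_smul, Matrix.smul_mul,
      smul_add, smul_sub, smul_neg, Matrix.mul_zero, sub_zero]
    abel
  refine HasDerivAt.deriv (hasDerivAt_iff_tendsto_slope.mpr ?_)
  have hlim : Filter.Tendsto
      (fun ε : ℝ => -D + Fᵀ * D * F - ε • ((Bᵀ * D * F)ᵀ * (S ε)⁻¹ * (Bᵀ * D * F)))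
      (nhds 0) (nhds (-D + Fᵀ * D * F)) := by
    have hcont : ContinuousAt
        (fun ε : ℝ => -D + Fᵀ * D * F - ε • ((Bᵀ * D * F)ᵀ * (S ε)⁻¹ * (Bᵀ * D * F))) 0 := by
      have hmul : Continuous fun T : Matrix (Fin m) (Fin m) ℝ =>
          (Bᵀ * D * F)ᵀ * T * (Bᵀ * D * F) := by fun_prop
      exact continuousAt_const.sub (continuousAt_id.smul (hmul.continuousAt.comp hSinv))
    simpa [ContinuousAt] using hcont
  refine (hlim.mono_left nhdsWithin_le_nhds).congr' ?_
  filter_upwards [hev.filter_mono nhdsWithin_le_nhds, self_mem_nhdsWithin] with ε hε hne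
  have hne : ε ≠ 0 := hne
  simp only [slope_def_module, sub_zero, zero_smul, add_zero]
  rw [hexp ε hε, add_sub_cancel_left, inv_smul_smul₀ hne]


/-- midpoint Newton equation as a Lyapunov equation: a symmetric `X` satisfies
`R′(M, X - P) = -R(P)` iff
`X = (A+BL)ᵀ X (A+BL) + [I;K]ᵀ Q [I;K] + (A+BK)ᵀ P (A+BK) - (A+BL)ᵀ P (A+BL)`,
where `K = K(P)`, `L = K(M)`. -/
theorem stmt11 {n m : ℕ}
    (A : Matrix (Fin n) (Fin n) ℝ) (B : Matrix (Fin n) (Fin m) ℝ)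
    (Qxx : Matrix (Fin n) (Fin n) ℝ) (Qxu : Matrix (Fin n) (Fin m) ℝ)
    (Quu : Matrix (Fin m) (Fin m) ℝ)
    (hQxx : Qxxᵀ = Qxx) (hQuu : Quuᵀ = Quu)
    (Q : Matrix (Fin n ⊕ Fin m) (Fin n ⊕ Fin m) ℝ)
    (hQ : Q = fromBlocks Qxx Qxu Qxuᵀ Quu)
    (P M : Matrix (Fin n) (Fin n) ℝ) (hP : Pᵀ = P) (hM : Mᵀ = M)
    (hinvP : IsUnit (Quu + Bᵀ * P * B)) (hinvM : IsUnit (Quu + Bᵀ * M * B))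
    (K L : Matrix (Fin m) (Fin n) ℝ)
    (hK : K = gainK A B Qxuᵀ Quu P) (hL : L = gainK A B Qxuᵀ Quu M)
    (X : Matrix (Fin n) (Fin n) ℝ) (hX : Xᵀ = X) :
    RiccDer A B Qxx Qxu Qxuᵀ Quu M (X - P) = -Ricc A B Qxx Qxu Qxuᵀ Quu P ↔
      X = (A + B * L)ᵀ * X * (A + B * L) + (stackIK K)ᵀ * Q * stackIK K +
          (A + B * K)ᵀ * P * (A + B * K) - (A + B * L)ᵀ * P * (A + B * L) := by
  have hK0 := gainK_residual A B Qxuᵀ Quu P hinvP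
  have hder := RiccDer_eq A B Qxx Qxu Quu hQuu M (X - P) hM (by simp [hX, hP]) hinvM
  rw [← hL] at hder
  rw [← hK] at hK0
  rw [hder, Ricc_eq_sub_square A B Qxx Qxu Quu hQuu P hP hinvP K, hK0, ← hQ,
    Matrix.mul_zero, sub_zero, Matrix.mul_sub, Matrix.sub_mul]
  generalize (A + B * L)ᵀ * X * (A + B * L) = a
  generalize (A + B * L)ᵀ * P * (A + B * L) = b
  generalize (A + B * K)ᵀ * P * (A + B * K) = c
  generalize (stackIK K)ᵀ * Q * stackIK K = d
  rw [← sub_eq_zero, eq_comm (a := X), ← sub_eq_zero (b := X)]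
  have hcomb : -(X - P) + (a - b) - -(-P + d + c) = a + d + c - b - X := by abel
  rw [hcomb]
end
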